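/- Let p, h, s : ℕ → ℕ be sequences satisfying h(n) + s(n) ≤ p(n) for every n ≥ 1, and define the partial sums P(n) = Σ_{k=1}^{n} p(k), H(n) = Σ_{k=1}^{n} h(k), S(n) = Σ_{k=1}^{n} s(k). Suppose that: (a) there is a real number B ≥ 1 such that p(n) ≤ B^n for all n ≥ 1; (b) the sequence of real numbers H(n)/P(n) tends to 1 as n → ∞; and (c) there exist a real ε > 0 and N ∈ ℕ such that S(n+17) ≥ ε·H(n) for all n > N. Then these assumptions are contradictory (i.e., no such sequences exist). -/

import Mathlib

open Filter

/-- The arithmetic core of the paper's main Theorem 1: if `p n`, `h n`, `s n`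
count prime, hyperbolic, and prime satellite knots of exactly `n` crossings,
with `h n + s n ≤ p n`, `p n` at most exponential, the cumulative ratio
`H n / P n → 1`, and `S (n+17) ≥ ε · H n` eventually, then we get a
contradiction. -/
theorem stmt_0 (p h s : ℕ → ℕ)
    (hle : ∀ n ≥ 1, h n + s n ≤ p n)
    (P H S : ℕ → ℕ)
    (hP : ∀ n, P n = ∑ k ∈ Finset.Icc 1 n, p k)
    (hH : ∀ n, H n = ∑ k ∈ Finset.Icc 1 n, h k)
    (hS : ∀ n, S n = ∑ k ∈ Finset.Icc 1 n, s k)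
    (B : ℝ) (hB : 1 ≤ B) (hpB : ∀ n ≥ 1, (p n : ℝ) ≤ B ^ n)
    (hHP : Tendsto (fun n => (H n : ℝ) / (P n : ℝ)) atTop (nhds 1))
    (ε : ℝ) (hε : 0 < ε) (N : ℕ)
    (hSH : ∀ n > N, ε * (H n : ℝ) ≤ (S (n + 17) : ℝ)) :
    False := by
  have hsum : ∀ n, (H n : ℝ) + S n ≤ P n := by
    intro n
    have : H n + S n ≤ P n := by
      rw [hP, hH, hS, ← Finset.sum_add_distrib]
      exact Finset.sum_le_sum fun k hk => hle k (Finset.mem_Icc.1 hk).1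
    exact_mod_cast this
  have hB0 : (0:ℝ) < B := by linarith
  have hPB : ∀ n, (P n : ℝ) ≤ (2 * B) ^ n := by
    intro n
    have h1 : (P n : ℝ) ≤ ∑ k ∈ Finset.Icc 1 n, B ^ n := by
      rw [hP]
      push_cast
      refine Finset.sum_le_sum fun k hk => ?_
      have hk' := Finset.mem_Icc.1 hk
      exact (hpB k hk'.1).trans (pow_le_pow_right₀ hB hk'.2)
    rw [Finset.sum_const, Nat.card_Icc, nsmul_eq_mul] at h1
    rw [mul_pow]
    refine h1.trans ?_
    have h2 : ((n + 1 - 1 : ℕ) : ℝ) ≤ 2 ^ n := by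
      have := (Nat.lt_two_pow_self (n := n)).le
      simp only [Nat.add_sub_cancel]
      exact_mod_cast this
    gcongr
  obtain ⟨D, hD⟩ : ∃ D : ℝ, D = (2 * B) ^ 17 := ⟨_, rfl⟩
  have hD0 : 0 < D := by rw [hD]; positivity
  obtain ⟨δ, hδ⟩ : ∃ δ : ℝ, δ = ε / (4 * D) := ⟨_, rfl⟩
  have hδ0 : 0 < δ := by rw [hδ]; positivity
  have e1 := hHP.eventually (lt_mem_nhds (show 1 - δ < 1 by linarith))
  have e2 := hHP.eventually (lt_mem_nhds (show (1/2:ℝ) < 1 by norm_num))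
  obtain ⟨M, hM⟩ := eventually_atTop.1 (e1.and (e2.and (eventually_gt_atTop N)))
  have key : ∀ n ≥ M, (1:ℝ) ≤ P n ∧ 2 * D * P n ≤ P (n + 17) := by
    intro n hn
    obtain ⟨-, b, c⟩ := hM n hn
    obtain ⟨a', b', -⟩ := hM (n + 17) (by omega)
    have pos : ∀ m, 1 / 2 < (H m : ℝ) / P m → (0:ℝ) < P m := by
      intro m hm
      rcases Nat.eq_zero_or_pos (P m) with h0 | h0
      · rw [h0] at hm; norm_num at hm
      · exact_mod_cast h0
    have p1 := pos n b
    have p2 := pos _ b'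
    rw [lt_div_iff₀ p1] at b
    rw [lt_div_iff₀ p2] at a'
    refine ⟨by exact_mod_cast p1, ?_⟩
    have h3 := hSH n c
    have h4 := hsum (n + 17)
    have h5 : ε * (P n / 2) ≤ δ * P (n + 17) := by
      have : ε * ((P n : ℝ) / 2) ≤ ε * H n := by
        apply mul_le_mul_of_nonneg_left _ hε.le
        linarith
      linarith
    have h6 : ε = δ * (4 * D) := by rw [hδ]; field_simp
    rw [h6] at h5
    refine le_of_mul_le_mul_left ?_ hδ0
    linarith
  have it : ∀ k : ℕ, (2 * D) ^ k ≤ P (M + 17 * k) := by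
    intro k
    induction k with
    | zero => simpa using (key M le_rfl).1
    | succ k ih =>
      have := (key (M + 17 * k) (by omega)).2
      rw [pow_succ, show M + 17 * (k + 1) = M + 17 * k + 17 by ring]
      nlinarith
  obtain ⟨k, hk⟩ := pow_unbounded_of_one_lt ((2 * B) ^ M) (one_lt_two (α := ℝ))
  have h7 := (it k).trans (hPB _)
  rw [pow_add, pow_mul, ← hD, mul_pow] at h7
  have := le_of_mul_le_mul_right h7 (pow_pos hD0 k)
  linarith
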